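/- arXiv:1903.10799 — 2 statements merged into one kernel-verified Lean document; each statement's English description precedes it below -/
import Mathlib

section
/- (Trigub, 1999) For all r, s ∈ ℕ ∪ {0} there exists a constant c(r,s) such that for every integer n ≥ 2r+1, every y ∈ (−1,1), there exists a real algebraic polynomial p_{n,y} of degree at most n (in the variable x) such that for all x ∈ [−1,1]: |sign(x − y) − p_{n,y}(x)| ≤ c(r,s)·( (1−x²) / (1−x² + 1−y² + (1/n²)|sign x − sign y|) )^r · ( δ_n(y) / (|x − y| + δ_n(y)) )^s, where δ_n(y) = √(1−y²)/n + 1/n². -/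
open Real

theorem sg_mono {F H : ℝ → ℝ} {F' H' : ℝ → ℝ} {a b : ℝ} (hab : a ≤ b)
    (hF : ∀ u ∈ Set.Icc a b, HasDerivAt F (F' u) u)
    (hH : ∀ u ∈ Set.Icc a b, HasDerivAt H (H' u) u)
    (hle : ∀ u ∈ Set.Ioo a b, F' u ≤ H' u) : F b - F a ≤ H b - H a := by
  have hm : MonotoneOn (fun u => H u - F u) (Set.Icc a b) := by
    apply monotoneOn_of_hasDerivWithinAt_nonneg (f' := fun u => H' u - F' u) (convex_Icc a b)
    · intro u hu
      exact ((hH u hu).sub (hF u hu)).continuousAt.continuousWithinAt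
    · intro u hu
      exact ((hH u (interior_subset hu)).sub (hF u (interior_subset hu))).hasDerivWithinAt
    · intro u hu
      rw [interior_Icc] at hu
      have := hle u hu
      linarith
  have := hm (Set.left_mem_Icc.2 hab) (Set.right_mem_Icc.2 hab) hab
  simp only at this
  linarith

theorem sg_antideriv (P : Polynomial ℝ) :
    ∃ F : Polynomial ℝ, F.derivative = P ∧ F.natDegree ≤ P.natDegree + 1 := by
  refine ⟨∑ i ∈ Finset.range (P.natDegree + 1),
    Polynomial.monomial (i + 1) (P.coeff i / (i + 1)), ?_, ?_⟩
  · rw [Polynomial.derivative_sum]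
    conv_rhs => rw [P.as_sum_range]
    refine Finset.sum_congr rfl fun i _ => ?_
    rw [Polynomial.derivative_monomial]
    have : ((i : ℝ) + 1) ≠ 0 := by positivity
    simp only [Nat.add_sub_cancel]
    congr 1
    push_cast
    field_simp
  · apply Polynomial.natDegree_sum_le_of_forall_le
    intro i hi
    refine (Polynomial.natDegree_monomial_le _).trans ?_
    have := Finset.mem_range.1 hi
    omega

theorem sg_kernel (N : ℕ) (hN : 1 ≤ N) (θ : ℝ) (h1 : π / (2 * N) ≤ θ) (h2 : θ ≤ π / 2)
    (h0 : cos (N * θ) = 0) :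
    ∃ l : Polynomial ℝ, l.natDegree ≤ N - 1 ∧
      (∀ u ∈ Set.Icc (-1 : ℝ) 1, u ≠ cos θ →
        |l.eval u| ≤ 3 * ((sin θ / N) / (|u - cos θ| + sin θ / N))) ∧
      (∀ u ∈ Set.Ico (cos θ - sin θ / N / 2) (cos θ), 1 / 3 ≤ |l.eval u|) := by
  have hNpos : (0 : ℝ) < N := by exact_mod_cast hN
  have hN1 : (1 : ℝ) ≤ N := by exact_mod_cast hN
  have hpi := Real.pi_pos
  have hθ : 0 < θ := lt_of_lt_of_le (by positivity) h1
  have hsin : 0 < sin θ := Real.sin_pos_of_pos_of_lt_pi hθ (by linarith)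
  have hcos : 0 ≤ cos θ := Real.cos_nonneg_of_neg_pi_div_two_le_of_le (by linarith) h2
  have hsin1 : 1 / (N : ℝ) ≤ sin θ := by
    have := Real.mul_le_sin hθ.le h2
    refine le_trans ?_ this
    calc 1 / (N : ℝ) = 2 / π * (π / (2 * N)) := by field_simp
      _ ≤ _ := by gcongr
  have hsN : sin (N * θ) ^ 2 = 1 := by
    have := Real.sin_sq_add_cos_sq (N * θ)
    rw [h0] at this; linarith
  have hsN1 : |sin (N * θ)| = 1 := by
    rw [← sq_eq_sq₀ (abs_nonneg _) zero_le_one, sq_abs, hsN]; norm_num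
  have habs : ∀ α : ℝ, |cos (N * (θ + α))| = |sin (N * α)| := by
    intro α
    rw [mul_add, Real.cos_add, h0, zero_mul, zero_sub, abs_neg, abs_mul, hsN1, one_mul]
  set T := Polynomial.Chebyshev.T ℝ (N : ℤ) with hT
  have hTe : ∀ x, T.eval (cos x) = cos (N * x) := by
    intro x
    have := Polynomial.Chebyshev.T_real_cos x (N : ℤ)
    rw [hT, this]; simp
  have hroot : T.IsRoot (cos θ) := by
    rw [Polynomial.IsRoot, hTe, h0]
  set q := T /ₘ (Polynomial.X - Polynomial.C (cos θ)) with hq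
  have hqT : (Polynomial.X - Polynomial.C (cos θ)) * q = T :=
    Polynomial.mul_divByMonic_eq_iff_isRoot.2 hroot
  have hqe : ∀ x, (cos x - cos θ) * q.eval (cos x) = cos (N * x) := by
    intro x
    rw [← hTe, ← hqT]; simp
  have hNsin : ∀ β : ℝ, |sin (N * β)| ≤ N * |sin β| := by
    intro β
    clear * - 
    induction N with
    | zero => simp
    | succ k ih =>
      push_cast
      rw [add_mul, one_mul, Real.sin_add]
      calc _ ≤ |sin (k * β) * cos β| + |cos (k * β) * sin β| := abs_add_le _ _
        _ ≤ |sin (k * β)| * 1 + 1 * |sin β| := by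
          rw [abs_mul, abs_mul]
          gcongr
          · exact Real.abs_cos_le_one _
          · exact Real.abs_cos_le_one _
        _ ≤ _ := by linarith
  refine ⟨Polynomial.C (sin θ / N) * q, ?_, ?_, ?_⟩
  · refine (Polynomial.natDegree_C_mul_le _ _).trans ?_
    rw [hq, Polynomial.natDegree_divByMonic _ (Polynomial.monic_X_sub_C _)]
    have : T.natDegree = N := by
      rw [hT, Polynomial.Chebyshev.natDegree_T]; simp
    rw [this, Polynomial.natDegree_X_sub_C]
  · intro u hu hne
    have hΔ : 0 < sin θ / N := by positivity
    rw [Polynomial.eval_mul, Polynomial.eval_C, abs_mul, abs_of_pos hΔ]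
    obtain ⟨x, hx0, hxpi, rfl⟩ : ∃ x, 0 ≤ x ∧ x ≤ π ∧ cos x = u :=
      ⟨arccos u, arccos_nonneg u, arccos_le_pi u, cos_arccos hu.1 hu.2⟩
    have hpos : 0 < |cos x - cos θ| := abs_pos.2 (sub_ne_zero.2 hne)
    have hmul : |cos x - cos θ| * |q.eval (cos x)| = |cos (N * x)| := by
      rw [← abs_mul, hqe]
    have hle1 : |cos x - cos θ| * |q.eval (cos x)| ≤ 1 := by
      rw [hmul]; exact Real.abs_cos_le_one _
    have hle2 : sin θ / N * |q.eval (cos x)| ≤ 2 := by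
      have e1 : |cos (N * x)| ≤ 2 * N * |sin ((x - θ) / 2)| := by
        have := habs (x - θ)
        rw [add_sub_cancel] at this
        rw [this]
        have e : (N : ℝ) * (x - θ) = 2 * (N * ((x - θ) / 2)) := by ring
        rw [e, Real.sin_two_mul, abs_mul, abs_mul, abs_two]
        have a1 := hNsin ((x - θ) / 2)
        have a2 := Real.abs_cos_le_one (N * ((x - θ) / 2))
        have a3 := abs_nonneg (sin (N * ((x - θ) / 2)))
        nlinarith [abs_nonneg (cos (N * ((x - θ) / 2)))]
      have e2 : |cos x - cos θ| = 2 * sin ((x + θ) / 2) * |sin ((x - θ) / 2)| := by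
        rw [Real.cos_sub_cos, abs_mul, abs_mul, abs_neg, abs_two,
          abs_of_nonneg (Real.sin_nonneg_of_nonneg_of_le_pi (by linarith) (by linarith))]
      have e3 : sin θ ≤ 2 * sin ((x + θ) / 2) := by
        have b1 : sin θ ≤ 2 * sin (θ / 2) := by
          have e : θ = 2 * (θ / 2) := by ring
          have h3 : 0 ≤ sin (θ / 2) :=
            Real.sin_nonneg_of_nonneg_of_le_pi (by linarith) (by linarith)
          conv_lhs => rw [e, Real.sin_two_mul]
          nlinarith [Real.cos_le_one (θ / 2)]
        have b2 : sin (θ / 2) ≤ sin ((x + θ) / 2) := by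
          rcases le_total ((x + θ) / 2) (π / 2) with h | h
          · exact Real.sin_le_sin_of_le_of_le_pi_div_two (by linarith) h (by linarith)
          · rw [← Real.sin_pi_sub ((x + θ) / 2)]
            exact Real.sin_le_sin_of_le_of_le_pi_div_two (by linarith) (by linarith) (by linarith)
        linarith
      have e4 : 0 < |sin ((x - θ) / 2)| := by
        rcases (abs_nonneg (sin ((x - θ) / 2))).lt_or_eq with h | h
        · exact h
        · rw [← h, mul_zero] at e2; linarith
      have e5 : sin ((x + θ) / 2) * |q.eval (cos x)| ≤ N := by
        rw [← hmul, e2] at e1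
        have : |sin ((x - θ) / 2)| * (sin ((x + θ) / 2) * |q.eval (cos x)|)
          ≤ |sin ((x - θ) / 2)| * N := by linarith
        exact le_of_mul_le_mul_left this e4
      rw [div_mul_eq_mul_div, div_le_iff₀ hNpos]
      nlinarith [abs_nonneg (q.eval (cos x))]
    rw [mul_div_assoc', le_div_iff₀ (by positivity)]
    nlinarith
  · intro u hu
    have hΔ : 0 < sin θ / N := by positivity
    rw [Polynomial.eval_mul, Polynomial.eval_C, abs_mul, abs_of_pos hΔ]
    have hΔ1 : sin θ / N ≤ 1 := by
      rw [div_le_one hNpos]; linarith [Real.sin_le_one θ]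
    have hu1 : -1 ≤ u := by linarith [hu.1]
    have hu2 : u ≤ 1 := by linarith [hu.2, Real.cos_le_one θ]
    set α := arccos u - θ with hα
    have hxα : arccos u = θ + α := by rw [hα]; ring
    have hcu : cos (θ + α) = u := by rw [← hxα, cos_arccos hu1 hu2]
    have hα0 : 0 < α := by
      have : arccos (cos θ) < arccos u := Real.arccos_lt_arccos hu1 hu.2 (Real.cos_le_one _)
      rw [Real.arccos_cos hθ.le (by linarith)] at this
      linarith
    have hinvN : 1 / (N : ℝ) ≤ 1 := by rw [div_le_one hNpos]; exact hN1
    have hinv0 : 0 < 1 / (N : ℝ) := by positivity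
    have hpi3 := Real.pi_gt_three
    have hpi4 := Real.pi_lt_d2
    have h2pi : 1 / 2 ≤ 2 / π := by
      rw [div_le_div_iff₀ (by norm_num) hpi]; linarith
    have hα1 : α ≤ 1 / N := by
      have k1 : cos (θ + 1 / N) ≤ u := by
        refine le_trans ?_ hu.1
        rw [Real.cos_add]
        have k2 : 1 / 2 * (1 / (N : ℝ)) ≤ sin (1 / N) := by
          refine le_trans ?_ (Real.mul_le_sin hinv0.le (by linarith))
          exact mul_le_mul_of_nonneg_right h2pi hinv0.le
        have k3 : sin θ * (1 / 2 * (1 / (N : ℝ))) ≤ sin θ * sin (1 / N) := by gcongr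
        have k4 : cos θ * cos (1 / N) ≤ cos θ * 1 := by
          gcongr; exact Real.cos_le_one _
        have k5 : sin θ * (1 / 2 * (1 / (N : ℝ))) = sin θ / N / 2 := by ring
        linarith
      have k6 := Real.arccos_le_arccos k1
      rw [Real.arccos_cos (by linarith) (by linarith)] at k6
      linarith
    have hm := hqe (θ + α)
    rw [hcu] at hm
    have hmul : |u - cos θ| * |q.eval u| = |sin (N * α)| := by
      rw [← abs_mul, hm, habs]
    have hNα : N * α ≤ 1 := by
      rw [le_div_iff₀ hNpos] at hα1; linarith
    have hlow : 1 / 2 * (N * α) ≤ |sin (N * α)| := by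
      refine le_trans ?_ (le_abs_self _)
      refine le_trans ?_ (Real.mul_le_sin (by positivity) (by linarith))
      exact mul_le_mul_of_nonneg_right h2pi (by positivity)
    have hup : |u - cos θ| ≤ 3 / 2 * (α * sin θ) := by
      rw [abs_of_neg (by linarith [hu.2]), ← hcu, Real.cos_add]
      have j1 := Real.one_sub_sq_div_two_le_cos (x := α)
      have j2 := Real.sin_le hα0.le
      have j3 : α * α ≤ α * sin θ := by gcongr; linarith
      have j4 : sin θ * sin α ≤ sin θ * α := by gcongr
      have j5 : cos θ * (1 - cos α) ≤ 1 * (1 - cos α) := by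
        exact mul_le_mul_of_nonneg_right (Real.cos_le_one θ) (by linarith [Real.cos_le_one α])
      nlinarith
    have hfin : α * (1 / 2 * N) ≤ α * (3 / 2 * sin θ * |q.eval u|) := by
      have := mul_le_mul_of_nonneg_right hup (abs_nonneg (q.eval u))
      rw [hmul] at this
      linarith
    have hfin2 := le_of_mul_le_mul_left hfin hα0
    rw [div_mul_eq_mul_div, le_div_iff₀ hNpos]
    linarith

set_option maxHeartbeats 4000000 in
theorem sg_main (r s : ℕ) : ∃ C : ℝ, 0 < C ∧ ∀ (t Δ : ℝ) (l : Polynomial ℝ),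
    0 ≤ t → t < 1 → 0 < Δ → Δ ≤ 1 → Δ ≤ 2 * (1 - t) →
    (∀ u ∈ Set.Icc (-1 : ℝ) 1, u ≠ t → |l.eval u| ≤ 3 * (Δ / (|u - t| + Δ))) →
    (∀ u ∈ Set.Ico (t - Δ / 2) t, 1 / 3 ≤ |l.eval u|) →
    ∃ p : Polynomial ℝ, p.natDegree ≤ 2 * (s + r + 2) * l.natDegree + (2 * r + 1) ∧
      (∀ x ∈ Set.Icc (-1 : ℝ) 1, |p.eval x| ≤ 1) ∧
      (∀ x ∈ Set.Icc t 1, 1 - p.eval x ≤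
        C * (((1 - x) / (1 - t)) ^ (r + 1) * (Δ / (|x - t| + Δ)) ^ s)) ∧
      (∀ x ∈ Set.Icc (-1) t, 1 + p.eval x ≤ C * (Δ / (|x - t| + Δ)) ^ s) ∧
      (∀ x ∈ Set.Icc (-1 : ℝ) 0, 1 + p.eval x ≤
        C * ((1 + x) ^ (r + 1) * (Δ / (|x - t| + Δ)) ^ s)) := by
  set m := s + r + 2 with hm
  refine ⟨4 * 8 ^ r * 81 ^ m, by positivity, ?_⟩
  intro t Δ l ht0 ht1 hΔ hΔ1 hΔt hup hlow
  have h1t : 0 < 1 - t := by linarith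
  set W : Polynomial ℝ := (1 - Polynomial.X ^ 2) ^ r * l ^ (2 * m) with hW
  have hWe : ∀ u, W.eval u = (1 - u ^ 2) ^ r * |l.eval u| ^ (2 * m) := by
    intro u
    rw [hW]
    simp only [Polynomial.eval_mul, Polynomial.eval_pow, Polynomial.eval_sub, Polynomial.eval_one,
      Polynomial.eval_X]
    rw [pow_mul |l.eval u|, sq_abs, ← pow_mul]
  have hWd : W.natDegree ≤ 2 * m * l.natDegree + 2 * r := by
    rw [hW]
    refine Polynomial.natDegree_mul_le.trans ?_
    have a1 : ((1 - Polynomial.X ^ 2 : Polynomial ℝ) ^ r).natDegree ≤ r * 2 := by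
      refine Polynomial.natDegree_pow_le.trans ?_
      gcongr
      compute_degree
    have a2 : (l ^ (2 * m)).natDegree ≤ 2 * m * l.natDegree := Polynomial.natDegree_pow_le
    omega
  obtain ⟨F, hF, hFd⟩ := sg_antideriv W
  have hFder : ∀ u, HasDerivAt (fun v => F.eval v) (W.eval u) u := by
    intro u
    have := F.hasDerivAt u
    rwa [hF] at this
  have hWnn : ∀ u ∈ Set.Icc (-1 : ℝ) 1, 0 ≤ W.eval u := by
    intro u hu
    rw [hWe]
    have : 0 ≤ 1 - u ^ 2 := by nlinarith [hu.1, hu.2]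
    positivity
  have hFmono : ∀ a b, -1 ≤ a → a ≤ b → b ≤ 1 → F.eval a ≤ F.eval b := by
    intro a b ha hab hb
    have := sg_mono (F := fun _ => (0 : ℝ)) (F' := fun _ => 0) (H := fun v => F.eval v)
      (H' := fun v => W.eval v) hab (fun u _ => hasDerivAt_const _ _) (fun u _ => hFder u)
      (fun u hu => hWnn u ⟨by linarith [hu.1], by linarith [hu.2]⟩)
    linarith
  set I := F.eval 1 - F.eval (-1) with hI
  have hIlow : ((1 - t) / 2) ^ r * (1 / 3) ^ (2 * m) * (Δ / 2) ≤ I := by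
    have := sg_mono (F := fun v => ((1 - t) / 2) ^ r * (1 / 3) ^ (2 * m) * v)
      (F' := fun _ => ((1 - t) / 2) ^ r * (1 / 3) ^ (2 * m)) (H := fun v => F.eval v)
      (H' := fun v => W.eval v) (a := t - Δ / 2) (b := t) (by linarith)
      (fun u _ => by simpa using (hasDerivAt_id u).const_mul (((1 - t) / 2) ^ r * (1 / 3) ^ (2 * m)))
      (fun u _ => hFder u) (by
        intro u hu
        rw [hWe]
        have b1 := hlow u ⟨hu.1.le, hu.2⟩
        have b0 : 0 ≤ 1 - u ^ 2 := by nlinarith [hu.1, hu.2]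
        have b2 : (1 - t) / 2 ≤ 1 - u ^ 2 := by nlinarith [hu.1, hu.2]
        gcongr)
    have c1 := hFmono (-1) (t - Δ / 2) le_rfl (by linarith) (by linarith)
    have c2 := hFmono t 1 (by linarith) (by linarith) le_rfl
    have e : ((1 - t) / 2) ^ r * (1 / 3) ^ (2 * m) * (Δ / 2)
      = ((1 - t) / 2) ^ r * (1 / 3) ^ (2 * m) * t
        - ((1 - t) / 2) ^ r * (1 / 3) ^ (2 * m) * (t - Δ / 2) := by ring
    linarith
  have hIpos : 0 < I := lt_of_lt_of_le (by positivity) hIlow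
  have key : ∀ inc X : ℝ, 0 ≤ X → inc ≤ 9 ^ m * 4 ^ r * (1 - t) ^ r * Δ * X →
      2 * inc / I ≤ 4 * 8 ^ r * 81 ^ m * X := by
    intro inc X hX hinc
    rw [div_le_iff₀ hIpos]
    calc 2 * inc ≤ 2 * (9 ^ m * 4 ^ r * (1 - t) ^ r * Δ * X) := by linarith
      _ = 4 * 8 ^ r * 81 ^ m * X * (((1 - t) / 2) ^ r * (1 / 3) ^ (2 * m) * (Δ / 2)) := by
        have e1 : (8 : ℝ) ^ r = 4 ^ r * 2 ^ r := by rw [← mul_pow]; norm_num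
        have e2 : (81 : ℝ) ^ m = 9 ^ m * 9 ^ m := by rw [← mul_pow]; norm_num
        have e3 : (1 / 3 : ℝ) ^ (2 * m) = 1 / 9 ^ m := by
          rw [pow_mul, ← one_div_pow]; norm_num
        rw [e1, e2, e3, div_pow]
        field_simp
        ring
      _ ≤ _ := by gcongr
  -- the polynomial
  have hpe : ∀ x, (Polynomial.C (2 / I) * (F - Polynomial.C (F.eval (-1))) - 1).eval x
      = 2 * (F.eval x - F.eval (-1)) / I - 1 := by
    intro x
    simp only [Polynomial.eval_sub, Polynomial.eval_mul, Polynomial.eval_C, Polynomial.eval_one]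
    ring
  have hpe2 : ∀ x, 1 - (2 * (F.eval x - F.eval (-1)) / I - 1)
      = 2 * (F.eval 1 - F.eval x) / I := by
    intro x
    have : F.eval 1 - F.eval x = I - (F.eval x - F.eval (-1)) := by rw [hI]; ring
    rw [this]
    field_simp
    ring
  have hDle : ∀ u, Δ / (|u - t| + Δ) ≤ 1 := by
    intro u
    rw [div_le_one (by positivity)]
    linarith [abs_nonneg (u - t)]
  have hDpow : ∀ u, (Δ / (|u - t| + Δ)) ^ (2 * m)
      ≤ (Δ / (|u - t| + Δ)) ^ r * (Δ / (|u - t| + Δ)) ^ s * (Δ / (|u - t| + Δ)) ^ 2 := by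
    intro u
    rw [← pow_add, ← pow_add]
    exact pow_le_pow_of_le_one (by positivity) (hDle u) (by omega)
  have hlpow : ∀ u ∈ Set.Icc (-1 : ℝ) 1, u ≠ t → |l.eval u| ^ (2 * m)
      ≤ 9 ^ m * ((Δ / (|u - t| + Δ)) ^ r * (Δ / (|u - t| + Δ)) ^ s * (Δ / (|u - t| + Δ)) ^ 2) := by
    intro u hu hne
    calc |l.eval u| ^ (2 * m) ≤ (3 * (Δ / (|u - t| + Δ))) ^ (2 * m) := by
          gcongr; exact hup u hu hne
      _ = 9 ^ m * (Δ / (|u - t| + Δ)) ^ (2 * m) := by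
          rw [mul_pow, pow_mul 3]; norm_num
      _ ≤ _ := by gcongr; exact hDpow u
  -- left increments
  have hleft : ∀ (κ x : ℝ), 0 ≤ κ → -1 ≤ x → x ≤ t →
      (∀ u ∈ Set.Ioo (-1) x, W.eval u ≤ κ * (Δ / (|u - t| + Δ)) ^ 2) →
      F.eval x - F.eval (-1) ≤ κ * Δ ∧ F.eval x - F.eval (-1) ≤ κ * Δ * (1 + x) := by
    intro κ x hκ hx hxt hW'
    have d1 : 0 < t - x + Δ := by linarith
    have d2 : 0 < t - (-1) + Δ := by linarith
    have := sg_mono (F := fun v => F.eval v) (F' := fun v => W.eval v)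
      (H := fun v => κ * Δ ^ 2 * (t - v + Δ)⁻¹)
      (H' := fun v => κ * (Δ / (t - v + Δ)) ^ 2) hx (fun u _ => hFder u)
      (by
        intro u hu
        have d3 : t - u + Δ ≠ 0 := by linarith [hu.2]
        have := ((((hasDerivAt_id u).const_sub t).add_const Δ).inv d3).const_mul (κ * Δ ^ 2)
        refine this.congr_deriv ?_
        simp only [id]
        field_simp)
      (by
        intro u hu
        have h := hW' u hu
        rwa [abs_of_nonpos (by linarith [hu.2] : u - t ≤ 0), neg_sub] at h)
    have e : κ * Δ ^ 2 * (t - x + Δ)⁻¹ - κ * Δ ^ 2 * (t - (-1) + Δ)⁻¹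
      = κ * Δ * ((Δ / (t - x + Δ)) * ((1 + x) / (t - (-1) + Δ))) := by
      field_simp
      ring
    rw [e] at this
    have f1 : Δ / (t - x + Δ) ≤ 1 := by rw [div_le_one d1]; linarith
    have f1' : 0 ≤ Δ / (t - x + Δ) := by positivity
    have f2 : (1 + x) / (t - (-1) + Δ) ≤ 1 := by rw [div_le_one d2]; linarith
    have f2' : 0 ≤ (1 + x) / (t - (-1) + Δ) := div_nonneg (by linarith) d2.le
    have f3 : (1 + x) / (t - (-1) + Δ) ≤ 1 + x := div_le_self (by linarith) (by linarith)
    constructor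
    · refine this.trans ?_
      have := mul_le_one₀ f1 f2' f2
      exact mul_le_of_le_one_right (by positivity) this
    · refine this.trans ?_
      have : Δ / (t - x + Δ) * ((1 + x) / (t - (-1) + Δ)) ≤ 1 * (1 + x) := by gcongr
      rw [one_mul] at this
      gcongr
  refine ⟨Polynomial.C (2 / I) * (F - Polynomial.C (F.eval (-1))) - 1, ?_, ?_, ?_, ?_, ?_⟩
  · have : (Polynomial.C (2 / I) * (F - Polynomial.C (F.eval (-1))) - 1).natDegree
        ≤ F.natDegree := by
      refine (Polynomial.natDegree_sub_le _ _).trans ?_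
      rw [Polynomial.natDegree_one]
      refine max_le ?_ (Nat.zero_le _)
      refine (Polynomial.natDegree_C_mul_le _ _).trans ?_
      rw [Polynomial.natDegree_sub_C]
    omega
  · intro x hx
    rw [hpe]
    have g1 := hFmono (-1) x le_rfl hx.1 hx.2
    have g2 := hFmono x 1 hx.1 hx.2 le_rfl
    have g3 : 0 ≤ 2 * (F.eval x - F.eval (-1)) / I := by
      apply div_nonneg _ hIpos.le; linarith
    have g4 : 0 ≤ 2 * (F.eval 1 - F.eval x) / I := by
      apply div_nonneg _ hIpos.le; linarith
    rw [← hpe2] at g4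
    rw [abs_le]; constructor <;> linarith
  · intro x hx
    rw [hpe, hpe2]
    have hx1 : 0 ≤ 1 - x := by linarith [hx.2]
    apply key
    · positivity
    set κ := (2 * (1 - x)) ^ r * 9 ^ m * (Δ / (|x - t| + Δ)) ^ s with hκ
    have hκ0 : 0 ≤ κ := by positivity
    have hxt : 0 < x - t + Δ := by linarith [hx.1]
    have d2 : 0 < 1 - t + Δ := by linarith
    have := sg_mono (F := fun v => F.eval v) (F' := fun v => W.eval v)
      (H := fun v => -(κ * Δ ^ 2) * (v - t + Δ)⁻¹)
      (H' := fun v => κ * (Δ / (v - t + Δ)) ^ 2) hx.2 (fun u _ => hFder u)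
      (by
        intro u hu
        have d3 : u - t + Δ ≠ 0 := by linarith [hu.1]
        have := ((((hasDerivAt_id u).sub_const t).add_const Δ).inv d3).const_mul (-(κ * Δ ^ 2))
        refine this.congr_deriv ?_
        simp only [id]
        field_simp)
      (by
        intro u hu
        have hut : 0 ≤ u - t := by linarith [hu.1, hx.1]
        have h := hlpow u ⟨by linarith [hu.1, hx.1], hu.2.le⟩ (by linarith [hu.1, hx.1])
        rw [hWe, ← abs_of_nonneg hut, hκ]
        have i0 : 0 ≤ 1 - u ^ 2 := by nlinarith [hu.1, hu.2, hx.1]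
        have i1 : 1 - u ^ 2 ≤ 2 * (1 - x) := by nlinarith [hu.1, hu.2, hx.1]
        have i2 : Δ / (|u - t| + Δ) ≤ Δ / (|x - t| + Δ) := by
          have : |x - t| ≤ |u - t| := by
            rw [abs_of_nonneg hut, abs_of_nonneg (by linarith [hx.1])]
            linarith [hu.1]
          gcongr
        have i3 : (Δ / (|u - t| + Δ)) ^ r ≤ 1 := pow_le_one₀ (by positivity) (hDle u)
        calc (1 - u ^ 2) ^ r * |l.eval u| ^ (2 * m) ≤ (2 * (1 - x)) ^ r * (9 ^ m *
              (1 * (Δ / (|x - t| + Δ)) ^ s * (Δ / (|u - t| + Δ)) ^ 2)) := by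
              refine mul_le_mul (by gcongr) (h.trans ?_) (by positivity) (by positivity)
              gcongr
          _ = _ := by ring)
    have e : -(κ * Δ ^ 2) * (1 - t + Δ)⁻¹ - -(κ * Δ ^ 2) * (x - t + Δ)⁻¹
      = κ * Δ * ((Δ / (x - t + Δ)) * ((1 - x) / (1 - t + Δ))) := by
      field_simp
      ring
    rw [e] at this
    refine this.trans ?_
    have f1 : Δ / (x - t + Δ) ≤ 1 := by rw [div_le_one hxt]; linarith [hx.1]
    have f2 : (1 - x) / (1 - t + Δ) ≤ (1 - x) / (1 - t) := by gcongr; linarith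
    have f3 : (Δ / (x - t + Δ)) * ((1 - x) / (1 - t + Δ)) ≤ 1 * ((1 - x) / (1 - t)) := by
      gcongr
    calc κ * Δ * ((Δ / (x - t + Δ)) * ((1 - x) / (1 - t + Δ)))
        ≤ κ * Δ * (1 * ((1 - x) / (1 - t))) := by gcongr
      _ = 9 ^ m * 2 ^ r * (1 - t) ^ r * Δ *
          (((1 - x) / (1 - t)) ^ (r + 1) * (Δ / (|x - t| + Δ)) ^ s) := by
          rw [hκ, mul_pow, pow_succ ((1 - x) / (1 - t)), div_pow (1 - x)]
          field_simp
      _ ≤ _ := by gcongr; norm_num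
  · intro x hx
    rw [hpe, add_sub_cancel]
    apply key
    · positivity
    refine (hleft (9 ^ m * 4 ^ r * (1 - t) ^ r * (Δ / (|x - t| + Δ)) ^ s) x (by positivity)
      hx.1 hx.2 ?_).1.trans (le_of_eq (by ring))
    intro u hu
    have h := hlpow u ⟨hu.1.le, by linarith [hu.2, hx.2]⟩ (by linarith [hu.2, hx.2])
    rw [hWe]
    have hu0 : 0 ≤ 1 - u := by linarith [hu.2, hx.2]
    have i0 : 0 ≤ 1 - u ^ 2 := by nlinarith [hu.1, hu.2, hx.2]
    have i1 : 1 - u ^ 2 ≤ 2 * (1 - u) := by nlinarith [hu.1, hu.2, hx.2]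
    have i2 : Δ / (|u - t| + Δ) ≤ Δ / (|x - t| + Δ) := by
      have : |x - t| ≤ |u - t| := by
        rw [abs_of_nonpos (by linarith [hx.2]), abs_of_nonpos (by linarith [hx.2, hu.2])]
        linarith [hu.2]
      gcongr
    have i3 : (1 - u) * (Δ / (|u - t| + Δ)) ≤ 2 * (1 - t) := by
      rw [abs_of_nonpos (by linarith [hx.2, hu.2]), mul_div_assoc',
        div_le_iff₀ (by linarith [hx.2, hu.2])]
      nlinarith [hx.2, hu.2]
    calc (1 - u ^ 2) ^ r * |l.eval u| ^ (2 * m) ≤ (2 * (1 - u)) ^ r * (9 ^ m *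
          ((Δ / (|u - t| + Δ)) ^ r * (Δ / (|x - t| + Δ)) ^ s * (Δ / (|u - t| + Δ)) ^ 2)) := by
          refine mul_le_mul (by gcongr) (h.trans ?_) (by positivity) (by positivity)
          gcongr
      _ = 9 ^ m * (2 * ((1 - u) * (Δ / (|u - t| + Δ)))) ^ r * (Δ / (|x - t| + Δ)) ^ s
          * (Δ / (|u - t| + Δ)) ^ 2 := by rw [mul_pow, mul_pow, mul_pow]; ring
      _ ≤ 9 ^ m * (2 * (2 * (1 - t))) ^ r * (Δ / (|x - t| + Δ)) ^ s
          * (Δ / (|u - t| + Δ)) ^ 2 := by gcongr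
      _ = _ := by
        have : (2 * (2 * (1 - t))) ^ r = 4 ^ r * (1 - t) ^ r := by
          rw [← mul_pow]; congr 1; ring
        rw [this]; ring
  · intro x hx
    have hxt : x ≤ t := by linarith [hx.2]
    have hx1 : 0 ≤ 1 + x := by linarith [hx.1]
    rw [hpe, add_sub_cancel]
    apply key
    · positivity
    refine (hleft (9 ^ m * 4 ^ r * (1 - t) ^ r * (1 + x) ^ r * (Δ / (|x - t| + Δ)) ^ s) x
      (by positivity) hx.1 hxt ?_).2.trans (le_of_eq (by ring))
    intro u hu
    have h := hlpow u ⟨hu.1.le, by linarith [hu.2, hx.2]⟩ (by linarith [hu.2, hx.2])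
    rw [hWe]
    have i0 : 0 ≤ 1 - u ^ 2 := by nlinarith [hu.1, hu.2, hx.2]
    have i1 : 1 - u ^ 2 ≤ 2 * (1 + x) := by nlinarith [hu.1, hu.2, hx.2]
    have i2 : Δ / (|u - t| + Δ) ≤ Δ / (|x - t| + Δ) := by
      have : |x - t| ≤ |u - t| := by
        rw [abs_of_nonpos (by linarith), abs_of_nonpos (by linarith [hu.2])]
        linarith [hu.2]
      gcongr
    have i3 : Δ / (|u - t| + Δ) ≤ 2 * (1 - t) := by
      rw [abs_of_nonpos (by linarith [hx.2, hu.2]), div_le_iff₀ (by linarith [hx.2, hu.2])]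
      have j0 : 0 ≤ (1 - t) * (-u) := mul_nonneg h1t.le (by linarith [hu.2, hx.2])
      have j1 : Δ ≤ 2 * (1 - t) * (t + Δ) := by
        rcases le_total t (1 / 2) with h | h
        · nlinarith [mul_nonneg hΔ.le (by linarith : 0 ≤ 1 - 2 * t), mul_nonneg h1t.le ht0]
        · nlinarith [mul_le_mul_of_nonneg_right hΔt (by linarith : 0 ≤ 2 * t - 1),
            mul_nonneg h1t.le h1t.le]
      linarith
    calc (1 - u ^ 2) ^ r * |l.eval u| ^ (2 * m) ≤ (2 * (1 + x)) ^ r * (9 ^ m *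
          ((2 * (1 - t)) ^ r * (Δ / (|x - t| + Δ)) ^ s * (Δ / (|u - t| + Δ)) ^ 2)) := by
          refine mul_le_mul (by gcongr) (h.trans ?_) (by positivity) (by positivity)
          gcongr
      _ = _ := by
        rw [mul_pow, mul_pow]
        have : (4 : ℝ) ^ r = 2 ^ r * 2 ^ r := by rw [← mul_pow]; norm_num
        rw [this]; ring

theorem sg_node (N : ℕ) (hN : 1 ≤ N) (y : ℝ) (hy0 : 0 ≤ y) (hy1 : y < 1) :
    ∃ θ : ℝ, π / (2 * N) ≤ θ ∧ θ ≤ π / 2 ∧ cos (N * θ) = 0 ∧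
      1 - y ≤ 23 * (1 - cos θ) ∧ |y - cos θ| ≤ 10 * (sin θ / N) ∧
      sin θ / N ≤ Real.sqrt (1 - y ^ 2) / N + 4 / (N : ℝ) ^ 2 := by
  have hNpos : (0 : ℝ) < N := by exact_mod_cast hN
  have hN1 : (1 : ℝ) ≤ N := by exact_mod_cast hN
  have hpi := Real.pi_pos
  have hpi3 := Real.pi_gt_three
  have hpi4 := Real.pi_lt_d2
  have hpisq : π ^ 2 ≤ 10 := by nlinarith
  set φ := arccos y with hφ
  have hcφ : cos φ = y := cos_arccos (by linarith) hy1.le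
  have hsφ : sin φ = Real.sqrt (1 - y ^ 2) := sin_arccos y
  have hφ0 : 0 < φ := arccos_pos.2 hy1
  have hφ2 : φ ≤ π / 2 := arccos_le_pi_div_two.2 hy0
  set j := ⌊N * φ / π - 1 / 2⌋₊ with hj
  set θ := (2 * j + 1) * (π / (2 * N)) with hθ
  have hbase : 0 < π / (2 * N) := by positivity
  have hθ1 : π / (2 * N) ≤ θ := by
    rw [hθ]
    have : (0 : ℝ) ≤ j := Nat.cast_nonneg _
    nlinarith
  have hNθ : (N : ℝ) * θ = j * π + π / 2 := by
    rw [hθ]; field_simp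
  have hdist : θ ≤ π / 2 ∧ |φ - θ| ≤ π / N := by
    have e : π / (N : ℝ) = 2 * (π / (2 * N)) := by field_simp
    rcases le_or_gt 0 (N * φ / π - 1 / 2) with h | h
    · have f1 := Nat.floor_le h
      have f2 := Nat.lt_floor_add_one (N * φ / π - 1 / 2)
      rw [← hj] at f1 f2
      have eφ : φ = (2 * (N * φ / π)) * (π / (2 * N)) := by field_simp
      have g1 : θ ≤ φ := by
        rw [eφ, hθ]
        gcongr
        linarith
      have g2 : φ ≤ θ + π / N := by
        rw [e]
        have : φ ≤ (2 * (j : ℝ) + 3) * (π / (2 * N)) := by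
          conv_lhs => rw [eφ]
          gcongr
          linarith
        rw [hθ]; linarith
      exact ⟨by linarith, by rw [abs_of_nonneg (by linarith)]; linarith⟩
    · have j0 : j = 0 := by rw [hj]; exact Nat.floor_of_nonpos h.le
      have eθ : θ = π / (2 * N) := by rw [hθ, j0]; simp
      have g1 : φ ≤ θ := by
        rw [eθ, le_div_iff₀ (by positivity)]
        have : N * φ / π < 1 / 2 := by linarith
        rw [div_lt_iff₀ hpi] at this
        linarith
      refine ⟨?_, ?_⟩
      · rw [eθ]; gcongr; linarith
      · rw [abs_of_nonpos (by linarith), e, ← eθ]; linarith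
  obtain ⟨hθ2, hd⟩ := hdist
  have hθ0 : 0 < θ := lt_of_lt_of_le hbase hθ1
  have hd' : |φ - θ| ≤ 2 * θ := by
    have e : π / (N : ℝ) = 2 * (π / (2 * N)) := by field_simp
    linarith
  have hφθ : φ ≤ 3 * θ := by linarith [le_abs_self (φ - θ)]
  have hsinθ : θ ≤ π / 2 * sin θ := by
    have := Real.mul_le_sin hθ0.le hθ2
    calc θ = π / 2 * (2 / π * θ) := by field_simp
      _ ≤ _ := by gcongr
  have hsin : 0 < sin θ := Real.sin_pos_of_pos_of_lt_pi hθ0 (by linarith)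
  refine ⟨θ, hθ1, hθ2, ?_, ?_, ?_, ?_⟩
  · rw [hNθ, Real.cos_add_pi_div_two, Real.sin_nat_mul_pi, neg_zero]
  · have a1 := Real.one_sub_sq_div_two_le_cos (x := φ)
    rw [hcφ] at a1
    have a2 := Real.cos_le_one_sub_mul_cos_sq (x := θ) (by rw [abs_of_pos hθ0]; linarith)
    have a3 : φ ^ 2 ≤ 9 * θ ^ 2 := by nlinarith
    have a4 : 1 / 5 ≤ 2 / π ^ 2 := by
      rw [div_le_div_iff₀ (by norm_num) (by positivity)]; linarith
    have a5 : 1 / 5 * θ ^ 2 ≤ 2 / π ^ 2 * θ ^ 2 := by gcongr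
    have a6 : 0 ≤ θ ^ 2 := by positivity
    linarith
  · rw [← hcφ, Real.cos_sub_cos, abs_mul, abs_mul, abs_neg, abs_two]
    have b1 : |sin ((φ + θ) / 2)| ≤ 2 * θ := by
      refine Real.abs_sin_le_abs.trans ?_
      rw [abs_of_pos (by linarith)]; linarith
    have b2 : |sin ((φ - θ) / 2)| ≤ π / N / 2 := by
      refine Real.abs_sin_le_abs.trans ?_
      rw [abs_div, abs_two]; linarith
    calc 2 * |sin ((φ + θ) / 2)| * |sin ((φ - θ) / 2)| ≤ 2 * (2 * θ) * (π / N / 2) := by gcongr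
      _ ≤ 2 * (2 * (π / 2 * sin θ)) * (π / N / 2) := by gcongr
      _ = π ^ 2 * (sin θ / N) := by ring
      _ ≤ _ := by gcongr
  · rw [← hsφ]
    have c1 : sin θ ≤ sin φ + 4 / N := by
      have : |sin θ - sin φ| ≤ |θ - φ| := by
        rw [Real.sin_sub_sin, abs_mul, abs_mul, abs_two]
        have h1 := Real.abs_sin_le_abs (x := (θ - φ) / 2)
        rw [abs_div, abs_two] at h1
        have h2 := Real.abs_cos_le_one ((θ + φ) / 2)
        nlinarith [abs_nonneg (sin ((θ - φ) / 2)), abs_nonneg (cos ((θ + φ) / 2))]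
      rw [abs_sub_comm θ φ] at this
      have h3 : π / (N : ℝ) ≤ 4 / N := by gcongr; linarith
      linarith [le_abs_self (sin θ - sin φ)]
    calc sin θ / N ≤ (sin φ + 4 / N) / N := by gcongr
      _ = _ := by field_simp

theorem sg_sign_diff (x y : ℝ) : |Real.sign x - Real.sign y| ≤ 2 := by
  rcases Real.sign_apply_eq x with h | h | h <;> rcases Real.sign_apply_eq y with h' | h' | h' <;>
    rw [h, h'] <;> norm_num

set_option maxHeartbeats 4000000 in
theorem sg_half (r s : ℕ) :
    ∃ c : ℝ, 0 ≤ c ∧ ∀ n : ℕ, 2 * r + 1 ≤ n → ∀ y : ℝ, 0 ≤ y → y < 1 →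
      ∃ p : Polynomial ℝ, p.natDegree ≤ n ∧
        ∀ x ∈ Set.Icc (-1 : ℝ) 1,
          |Real.sign (x - y) - p.eval x| ≤
            c * ((1 - x ^ 2) /
                  (1 - x ^ 2 + (1 - y ^ 2) +
                    (1 / (n : ℝ) ^ 2) * |Real.sign x - Real.sign y|)) ^ (r + 1) *
              ((Real.sqrt (1 - y ^ 2) / n + 1 / (n : ℝ) ^ 2) /
                (|x - y| + (Real.sqrt (1 - y ^ 2) / n + 1 / (n : ℝ) ^ 2))) ^ s := by
  obtain ⟨C, hC, hmain⟩ := sg_main r s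
  set m := s + r + 2 with hm
  set K : ℝ := 2 * r + 1 + 2 * m with hK
  have hm0 : (2 : ℝ) ≤ m := by rw [hm]; push_cast; linarith [(Nat.cast_nonneg s : (0:ℝ) ≤ s), (Nat.cast_nonneg r : (0:ℝ) ≤ r)]
  have hK1 : 1 ≤ K := by rw [hK]; linarith [(Nat.cast_nonneg r : (0:ℝ) ≤ r)]
  set L : ℝ := 4 * K ^ 2 with hL
  have hL0 : 0 < L := by positivity
  set E : ℝ := 1 + 11 * L with hE
  have hE0 : 0 < E := by positivity
  refine ⟨(C + 2) * 200 ^ (r + 1) * E ^ s, by positivity, ?_⟩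
  intro n hn y hy0 hy1
  set N := (n - (2 * r + 1)) / (2 * m) + 1 with hNdef
  have hN : 1 ≤ N := Nat.le_add_left 1 _
  have hNpos : (0 : ℝ) < N := by exact_mod_cast hN
  have hN1 : (1 : ℝ) ≤ N := by exact_mod_cast hN
  have hnpos : (0 : ℝ) < n := by exact_mod_cast (by omega : 0 < n)
  have hn1 : (1 : ℝ) ≤ n := by exact_mod_cast (by omega : 1 ≤ n)
  have hdeg : 2 * m * (N - 1) + (2 * r + 1) ≤ n := by
    have := Nat.mul_div_le (n - (2 * r + 1)) (2 * m)
    rw [hNdef, Nat.add_sub_cancel]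
    omega
  have hnK : (n : ℝ) ≤ K * N := by
    have h1 : n - (2 * r + 1) < 2 * m * N := by
      rw [hNdef]
      exact Nat.lt_mul_div_succ _ (by omega)
    have h2 : n ≤ 2 * m * N + (2 * r + 1) := by omega
    have h3 : (n : ℝ) ≤ 2 * m * N + (2 * r + 1) := by exact_mod_cast h2
    have h4 : (2 * (r : ℝ) + 1) * 1 ≤ (2 * r + 1) * N := by gcongr
    rw [hK]; linarith
  obtain ⟨θ, hθ1, hθ2, hθ0, hyt, hytd, hΔδ⟩ := sg_node N hN y hy0 hy1
  obtain ⟨l, hld, hup, hlow⟩ := sg_kernel N hN θ hθ1 hθ2 hθ0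
  have hpi := Real.pi_pos
  have hθpos : 0 < θ := lt_of_lt_of_le (by positivity) hθ1
  have hsin : 0 < sin θ := Real.sin_pos_of_pos_of_lt_pi hθpos (by linarith)
  have hsin1 : 1 / (N : ℝ) ≤ sin θ := by
    have := Real.mul_le_sin hθpos.le hθ2
    refine le_trans ?_ this
    calc 1 / (N : ℝ) = 2 / π * (π / (2 * N)) := by field_simp
      _ ≤ _ := by gcongr
  have hssq := Real.sin_sq_add_cos_sq θ
  set t := cos θ with ht
  set Δ := sin θ / N with hΔ
  have ht0 : 0 ≤ t := Real.cos_nonneg_of_neg_pi_div_two_le_of_le (by linarith) hθ2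
  have ht1 : t < 1 := by nlinarith
  have hΔ0 : 0 < Δ := by positivity
  have hΔ1 : Δ ≤ 1 := by
    rw [hΔ, div_le_one hNpos]; linarith [Real.sin_le_one θ]
  have hΔt : Δ ≤ 2 * (1 - t) := by
    have : Δ ≤ sin θ * sin θ := by
      rw [hΔ, div_eq_mul_one_div]; gcongr
    nlinarith
  obtain ⟨p, hpd, hp1, hpa, hpb, hpc⟩ := hmain t Δ l ht0 ht1 hΔ0 hΔ1 hΔt hup hlow
  refine ⟨p, ?_, ?_⟩
  · refine hpd.trans (le_trans ?_ hdeg)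
    gcongr
  clear hup hlow hpd hmain
  set S := Real.sqrt (1 - y ^ 2) with hS
  have hS0 : 0 ≤ S := Real.sqrt_nonneg _
  set δ := S / n + 1 / (n : ℝ) ^ 2 with hδ
  have hδ0 : 0 < δ := by positivity
  have hΔL : Δ ≤ L * δ := by
    have h1 : 1 / (N : ℝ) ≤ K * (1 / n) := by
      rw [mul_one_div, div_le_div_iff₀ hNpos hnpos]; linarith
    have h2 : (1 / (N : ℝ)) ^ 2 ≤ (K * (1 / n)) ^ 2 := by gcongr
    have h3 : S * (1 / (N : ℝ)) ≤ S * (K * (1 / n)) := by gcongr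
    have h4 : S * (1 / n) * K ≤ S * (1 / n) * (4 * K ^ 2) := by gcongr; nlinarith
    calc Δ ≤ S / N + 4 / (N : ℝ) ^ 2 := hΔδ
      _ = S * (1 / N) + 4 * (1 / N) ^ 2 := by ring
      _ ≤ S * (1 / n) * (4 * K ^ 2) + 4 * (K * (1 / n)) ^ 2 := by linarith
      _ = L * δ := by rw [hL, hδ]; ring
  have hytL : |y - t| ≤ 10 * L * δ := by linarith
  clear hΔδ hytd hssq hsin1 hsin hθpos hpi hld hθ0 hθ1 hθ2 hnK hdeg hm0 hΔ1 hΔt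
  clear_value δ S Δ t N E L K m
  clear hK1 hδ hS hS0 hΔ ht hN1 hNpos hN hNdef hL hK hm
  intro x hx
  have hx1 := hx.1
  have hx2 := hx.2
  have hxsq : 0 ≤ 1 - x ^ 2 := by nlinarith
  have hysq : 0 < 1 - y ^ 2 := by nlinarith
  set g := 1 / (n : ℝ) ^ 2 * |Real.sign x - Real.sign y| with hg
  have hg0 : 0 ≤ g := by positivity
  have hn2 : 1 / (n : ℝ) ^ 2 ≤ 1 := by
    rw [div_le_one (by positivity)]; nlinarith
  have hgle : g ≤ |Real.sign x - Real.sign y| := mul_le_of_le_one_left (abs_nonneg _) hn2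
  set Z := 1 - x ^ 2 + (1 - y ^ 2) + g with hZ
  have hZ0 : 0 < Z := by linarith
  set A := (1 - x ^ 2) / Z with hA
  have hA0 : 0 ≤ A := by positivity
  set D := δ / (|x - y| + δ) with hD
  have hD0 : 0 ≤ D := by positivity
  have hDj : Δ / (|x - t| + Δ) ≤ E * D := by
    have h1 : |x - y| ≤ |x - t| + 10 * L * δ := by
      have := abs_sub_le x t y
      rw [abs_sub_comm t y] at this
      linarith
    rw [hD, mul_div_assoc', div_le_div_iff₀ (by positivity) (by positivity)]
    have h2 : Δ * |x - y| ≤ Δ * (|x - t| + 10 * L * δ) := by gcongr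
    have h3 : Δ * |x - t| ≤ L * δ * |x - t| := by gcongr
    have h4 : 0 ≤ δ * |x - t| := by positivity
    have h5 : 0 ≤ L * (δ * |x - t|) := by positivity
    have h6 : 0 ≤ L * (δ * Δ) := by positivity
    rw [hE]
    nlinarith
  have hDnear : |x - y| ≤ |y - t| → 1 ≤ E * D := by
    intro h
    rw [hD, mul_div_assoc', le_div_iff₀ (by positivity), hE]
    have : 0 ≤ L * δ := by positivity
    linarith
  have fin : ∀ B Y : ℝ, 0 ≤ B → B ≤ 200 * A → 0 ≤ Y → Y ≤ E * D →
      |Real.sign (x - y) - p.eval x| ≤ (C + 2) * (B ^ (r + 1) * Y ^ s) →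
      |Real.sign (x - y) - p.eval x| ≤ (C + 2) * 200 ^ (r + 1) * E ^ s * A ^ (r + 1) * D ^ s := by
    intro B Y hB hBA hY hYD h
    calc _ ≤ (C + 2) * (B ^ (r + 1) * Y ^ s) := h
      _ ≤ (C + 2) * ((200 * A) ^ (r + 1) * (E * D) ^ s) := by gcongr
      _ = _ := by rw [mul_pow, mul_pow]; ring
  have hpx := abs_le.1 (hp1 x hx)
  have triv : |Real.sign (x - y) - p.eval x| ≤ (C + 2) * (1 ^ (r + 1) * 1 ^ s) := by
    rw [one_pow, one_pow, abs_le]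
    rcases Real.sign_apply_eq (x - y) with h | h | h <;> rw [h] <;> constructor <;> linarith
  have hDj0 : 0 ≤ Δ / (|x - t| + Δ) := by positivity
  rcases lt_or_ge y x with hxy | hxy
  · -- x > y
    have hsg : Real.sign (x - y) = 1 := Real.sign_of_pos (by linarith)
    have hsq : y ^ 2 ≤ x ^ 2 := by gcongr
    have hZle : Z ≤ 3 * (1 - y ^ 2) := by
      rcases hy0.lt_or_eq with h | h
      · have : g ≤ 0 := by
          rw [Real.sign_of_pos h, Real.sign_of_pos (h.trans hxy)] at hgle
          simpa using hgle
        linarith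
      · have : g ≤ 1 := by
          rw [← h, Real.sign_zero, Real.sign_of_pos (by linarith)] at hgle
          simpa using hgle
        have h0 : y ^ 2 = 0 := by rw [← h]; norm_num
        linarith [sq_nonneg x]
    have hAlow : (1 - x) / (1 - y) ≤ 6 * A := by
      rw [hA, mul_div_assoc', div_le_div_iff₀ (by linarith) hZ0]
      have h1 : (1 - x) * Z ≤ (1 - x) * (3 * (1 - y ^ 2)) :=
        mul_le_mul_of_nonneg_left hZle (by linarith)
      have h2 : 0 ≤ (1 - x) * (1 - y) := mul_nonneg (by linarith) (by linarith)
      have h3 : (1 - x) * (1 - y) * (1 + y) ≤ (1 - x) * (1 - y) * (2 * (1 + x)) :=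
        mul_le_mul_of_nonneg_left (by linarith) h2
      linarith
    have hlt : (1 - x) / (1 - t) ≤ 23 * ((1 - x) / (1 - y)) := by
      rw [mul_div_assoc', div_le_div_iff₀ (by linarith) (by linarith)]
      have := mul_le_mul_of_nonneg_left hyt (by linarith : 0 ≤ 1 - x)
      linarith
    rcases le_or_gt t x with hxt | hxt
    · refine fin ((1 - x) / (1 - t)) (Δ / (|x - t| + Δ))
        (div_nonneg (by linarith) (by linarith)) (by linarith) hDj0 hDj ?_
      rw [hsg, abs_of_nonneg (by linarith)]
      refine (hpa x ⟨hxt, hx2⟩).trans ?_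
      have : 0 ≤ (1 - x) / (1 - t) := div_nonneg (by linarith) (by linarith)
      gcongr
      linarith
    · refine fin 1 1 zero_le_one ?_ zero_le_one (hDnear ?_) triv
      · have : 1 ≤ (1 - x) / (1 - t) := by rw [le_div_iff₀ (by linarith)]; linarith
        linarith
      · rw [abs_of_pos (by linarith), abs_of_neg (by linarith)]; linarith
  rcases le_or_gt 0 x with hx0 | hx0
  · -- 0 ≤ x ≤ y
    have hxsq' : 0 < 1 - x ^ 2 := by nlinarith
    have hsq : x ^ 2 ≤ y ^ 2 := by gcongr
    have hZle : Z ≤ 3 * (1 - x ^ 2) := by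
      rcases hx0.lt_or_eq with h | h
      · have : g ≤ 0 := by
          rw [Real.sign_of_pos h, Real.sign_of_pos (by linarith)] at hgle
          simpa using hgle
        linarith
      · have : g ≤ 1 := by
          rw [← h, Real.sign_zero] at hgle
          rcases Real.sign_apply_eq y with h' | h' | h' <;> rw [h'] at hgle <;>
            norm_num at hgle <;> linarith
        have h0 : x ^ 2 = 0 := by rw [← h]; norm_num
        linarith [sq_nonneg y]
    have hAlow : 1 ≤ 200 * A := by
      rw [hA, mul_div_assoc', le_div_iff₀ hZ0]; linarith
    rcases hxy.lt_or_eq with hlt | heq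
    · rcases le_or_gt x t with hxt | hxt
      · refine fin 1 (Δ / (|x - t| + Δ)) zero_le_one hAlow hDj0 hDj ?_
        rw [Real.sign_of_neg (by linarith), one_pow, one_mul, abs_of_nonpos (by linarith)]
        have h1 := hpb x ⟨hx1, hxt⟩
        have h2 : C * (Δ / (|x - t| + Δ)) ^ s ≤ (C + 2) * (Δ / (|x - t| + Δ)) ^ s := by
          gcongr; linarith
        linarith
      · refine fin 1 1 zero_le_one hAlow zero_le_one (hDnear ?_) triv
        rw [abs_of_neg (by linarith), abs_of_pos (by linarith)]; linarith
    · refine fin 1 1 zero_le_one hAlow zero_le_one (hDnear ?_) triv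
      rw [heq, sub_self, abs_zero]; exact abs_nonneg _
  · -- x < 0
    have hZle : Z ≤ 4 := by
      have := sg_sign_diff x y
      linarith [sq_nonneg x, sq_nonneg y]
    have hAlow : 1 + x ≤ 200 * A := by
      rw [hA, mul_div_assoc', le_div_iff₀ hZ0]
      have h1 := mul_le_mul_of_nonneg_left hZle (by linarith : 0 ≤ 1 + x)
      have h2 : 0 ≤ (1 + x) * (-x) := mul_nonneg (by linarith) (by linarith)
      linarith
    refine fin (1 + x) (Δ / (|x - t| + Δ)) (by linarith) hAlow hDj0 hDj ?_
    rw [Real.sign_of_neg (by linarith), abs_of_nonpos (by linarith)]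
    have h1 := hpc x ⟨hx1, hx0.le⟩
    have h0 : 0 ≤ 1 + x := by linarith
    have h2 : C * ((1 + x) ^ (r + 1) * (Δ / (|x - t| + Δ)) ^ s)
        ≤ (C + 2) * ((1 + x) ^ (r + 1) * (Δ / (|x - t| + Δ)) ^ s) := by
      gcongr; linarith
    linarith

/-- **Trigub, 1999.** For all `r, s ∈ ℕ ∪ {0}` there is `c(r,s)` such that for every
`n ≥ 2r+1` and every `y ∈ (−1,1)` there is a polynomial `p_{n,y}` of degree at most `n` with,
for all `x ∈ [−1,1]`,
`|sign(x−y) − p_{n,y}(x)| ≤ c(r,s)·((1−x²)/(1−x²+1−y²+(1/n²)|sign x − sign y|))^r ·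
(δ_n(y)/(|x−y|+δ_n(y)))^s`, where `δ_n(y) = √(1−y²)/n + 1/n²`. -/
theorem trigub_sign_approx (r s : ℕ) :
    ∃ c : ℝ, ∀ n : ℕ, 2 * r + 1 ≤ n → ∀ y ∈ Set.Ioo (-1 : ℝ) 1,
      ∃ p : Polynomial ℝ, p.natDegree ≤ n ∧
        ∀ x ∈ Set.Icc (-1 : ℝ) 1,
          |Real.sign (x - y) - p.eval x| ≤
            c * ((1 - x ^ 2) /
                  (1 - x ^ 2 + (1 - y ^ 2) +
                    (1 / (n : ℝ) ^ 2) * |Real.sign x - Real.sign y|)) ^ r *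
              ((Real.sqrt (1 - y ^ 2) / n + 1 / (n : ℝ) ^ 2) /
                (|x - y| + (Real.sqrt (1 - y ^ 2) / n + 1 / (n : ℝ) ^ 2))) ^ s := by
  obtain ⟨c, hc, hhalf⟩ := sg_half (r - 1) s
  have weaken : ∀ (n : ℕ) (x y e : ℝ), x ∈ Set.Icc (-1 : ℝ) 1 → y ∈ Set.Ioo (-1 : ℝ) 1 →
      e ≤ c * ((1 - x ^ 2) / (1 - x ^ 2 + (1 - y ^ 2) +
                    (1 / (n : ℝ) ^ 2) * |Real.sign x - Real.sign y|)) ^ (r - 1 + 1) *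
              ((Real.sqrt (1 - y ^ 2) / n + 1 / (n : ℝ) ^ 2) /
                (|x - y| + (Real.sqrt (1 - y ^ 2) / n + 1 / (n : ℝ) ^ 2))) ^ s →
      e ≤ c * ((1 - x ^ 2) / (1 - x ^ 2 + (1 - y ^ 2) +
                    (1 / (n : ℝ) ^ 2) * |Real.sign x - Real.sign y|)) ^ r *
              ((Real.sqrt (1 - y ^ 2) / n + 1 / (n : ℝ) ^ 2) /
                (|x - y| + (Real.sqrt (1 - y ^ 2) / n + 1 / (n : ℝ) ^ 2))) ^ s := by
    intro n x y e hx hy h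
    refine h.trans ?_
    have h1 : 0 ≤ 1 - x ^ 2 := by nlinarith [hx.1, hx.2]
    have h2 : 0 < 1 - y ^ 2 := by nlinarith [hy.1, hy.2]
    have h3 : 0 ≤ (1 / (n : ℝ) ^ 2) * |Real.sign x - Real.sign y| := by positivity
    refine mul_le_mul_of_nonneg_right (mul_le_mul_of_nonneg_left ?_ hc) (by positivity)
    refine pow_le_pow_of_le_one (by positivity) ?_ (by omega)
    rw [div_le_one (by positivity)]
    linarith
  refine ⟨c, ?_⟩
  intro n hn y hy
  rcases le_or_gt 0 y with h0 | h0
  · obtain ⟨p, hp, h⟩ := hhalf n (by omega) y h0 hy.2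
    exact ⟨p, hp, fun x hx => weaken n x y _ hx hy (h x hx)⟩
  · obtain ⟨p, hp, h⟩ := hhalf n (by omega) (-y) (by linarith) (by linarith [hy.1])
    refine ⟨-(p.comp (-Polynomial.X)), ?_, fun x hx => weaken n x y _ hx hy ?_⟩
    · rw [Polynomial.natDegree_neg, Polynomial.natDegree_comp, Polynomial.natDegree_neg,
        Polynomial.natDegree_X, mul_one]
      exact hp
    · have hh := h (-x) ⟨by linarith [hx.2], by linarith [hx.1]⟩
      have e1 : -x - -y = -(x - y) := by ring
      have e2 : Real.sign (-x) - Real.sign (-y) = -(Real.sign x - Real.sign y) := by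
        rw [Real.sign_neg, Real.sign_neg]; ring
      have e3 : |Real.sign (x - y) - (-(p.comp (-Polynomial.X))).eval x|
          = |Real.sign (-x - -y) - p.eval (-x)| := by
        rw [e1, Real.sign_neg, ← abs_neg]
        congr 1
        simp only [Polynomial.eval_neg, Polynomial.eval_comp, Polynomial.eval_X]
        ring
      rw [e3]
      rw [neg_sq, neg_sq, e2, abs_neg] at hh
      rw [show |x - y| = |-x - -y| by rw [e1, abs_neg]]
      exact hh
end

section
/- (Dzyadyk's geometric criterion of analyticity) Let D ⊆ ℂ ≅ ℝ² be a nonempty open connected set, and let u, v : D → ℝ be continuously differentiable with u(x,y)² + v(x,y)² > 0 for all (x,y) ∈ D, and set w = √(u² + v²) (which is then continuously differentiable on D). Then the following are equivalent: (i) at least one of the functions f = u + iv and f̄ = u − iv is holomorphic on D (as a function of x + iy); (ii) for every open set Ω with compact closure contained in D, the areas of the three graph surfaces are equal: ∫_Ω √(1 + u_x² + u_y²) dxdy = ∫_Ω √(1 + v_x² + v_y²) dxdy = ∫_Ω √(1 + w_x² + w_y²) dxdy. -/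
open Real MeasureTheory

/-- The area of the graph of a (continuously differentiable) function `g : ℝ² → ℝ` over a
set `Ω`: `∫_Ω √(1 + g_x² + g_y²)`. -/
noncomputable def graphArea (g : ℝ × ℝ → ℝ) (Ω : Set (ℝ × ℝ)) : ℝ :=
  ∫ p in Ω, Real.sqrt (1 + (fderiv ℝ g p (1, 0)) ^ 2 + (fderiv ℝ g p (0, 1)) ^ 2)

/-- Local form of the density part of Radó's theorem. -/
theorem rado_local (D : Set ℂ) (hD : IsOpen D) (g : ℂ → ℂ) (hg : ContinuousOn g D)
    (hd : DifferentiableOn ℂ g {z | z ∈ D ∧ g z ≠ 0}) (p : ℂ) (hp : p ∈ D)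
    (h1 : p ∈ closure {z | z ∈ D ∧ g z ≠ 0})
    (h2 : p ∈ closure (D \ closure {z | z ∈ D ∧ g z ≠ 0})) : False := by
  set A : Set ℂ := {z | z ∈ D ∧ g z ≠ 0} with hA
  have hAo : IsOpen A := hg.isOpen_inter_preimage hD (isOpen_compl_singleton (x := (0 : ℂ)))
  obtain ⟨R, hR, hRD⟩ := Metric.nhds_basis_closedBall.mem_iff.1 (hD.mem_nhds hp)
  obtain ⟨α, hα, hαp⟩ := Metric.mem_closure_iff.1 h1 (R / 8) (by positivity)
  obtain ⟨β, hβ, hβp⟩ := Metric.mem_closure_iff.1 h2 (R / 8) (by positivity)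
  obtain ⟨M, hM⟩ := (isCompact_closedBall p R).exists_bound_of_continuousOn (hg.mono hRD)
  have hgα : 0 < ‖g α‖ := norm_pos_iff.2 hα.2
  have hαβ : α ≠ β := fun h => hβ.2 (h ▸ subset_closure hα)
  have hM0 : 0 ≤ M := (norm_nonneg _).trans (hM p (Metric.mem_closedBall_self hR.le))
  set U : Set ℂ := A ∩ Metric.ball p R with hU
  have hUo : IsOpen U := hAo.inter Metric.isOpen_ball
  have hUcA : closure U ⊆ closure A := closure_mono Set.inter_subset_left
  have hUcB : closure U ⊆ Metric.closedBall p R :=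
    (closure_mono Set.inter_subset_right).trans Metric.closure_ball_subset_closedBall
  have hne : ∀ z ∈ closure U, z - β ≠ 0 := by
    intro z hz h
    rw [sub_eq_zero] at h
    exact hβ.2 (h ▸ hUcA hz)
  have key : ∀ n : ℕ, ‖g α‖ * 2 ^ n ≤ M := by
    intro n
    have hF : DiffContOnCl ℂ (fun z => g z * (((R / 2 : ℝ) : ℂ) / (z - β)) ^ n) U := by
      constructor
      · refine (hd.mono Set.inter_subset_left).mul (DifferentiableOn.pow ?_ n)
        refine DifferentiableOn.div (by fun_prop) (by fun_prop) ?_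
        exact fun z hz => hne z (subset_closure hz)
      · refine (hg.mono (hUcB.trans hRD)).mul (ContinuousOn.pow ?_ n)
        exact ContinuousOn.div (by fun_prop) (by fun_prop) hne
    have hb := Complex.norm_le_of_forall_mem_frontier_norm_le
      (Metric.isBounded_ball.subset (Set.inter_subset_right : U ⊆ Metric.ball p R)) hF (C := M)
      (by
        intro z hz
        have hzc : z ∈ closure U := frontier_subset_closure hz
        have hzU : z ∉ U := by
          rw [hUo.frontier_eq] at hz
          exact hz.2
        have hzB := hUcB hzc
        by_cases h0 : g z = 0
        · simpa [h0] using hM0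
        · have hzb : ¬ dist z p < R := fun h => hzU ⟨⟨hRD hzB, h0⟩, h⟩
          have h3 : R / 2 ≤ dist z β := by
            have := dist_triangle z β p
            rw [dist_comm β p] at this
            linarith
          have h4 : ‖((R / 2 : ℝ) : ℂ) / (z - β)‖ ≤ 1 := by
            rw [norm_div, Complex.norm_real, Real.norm_of_nonneg (by positivity), ← dist_eq_norm]
            exact (div_le_one (by linarith)).2 h3
          rw [norm_mul, norm_pow]
          calc _ ≤ M * 1 := mul_le_mul (hM z hzB) (pow_le_one₀ (norm_nonneg _) h4)
                  (by positivity) hM0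
            _ = M := mul_one M)
      (z := α) (subset_closure ⟨hα, by rw [Metric.mem_ball, dist_comm]; linarith⟩)
    refine le_trans ?_ hb
    rw [norm_mul, norm_pow]
    refine mul_le_mul_of_nonneg_left (pow_le_pow_left₀ (by norm_num) ?_ n) hgα.le
    rw [norm_div, Complex.norm_real, Real.norm_of_nonneg (by positivity), ← dist_eq_norm]
    rw [le_div_iff₀ (dist_pos.2 hαβ)]
    have := dist_triangle α p β
    rw [dist_comm α p] at this
    linarith
  obtain ⟨n, hn⟩ := pow_unbounded_of_one_lt (M / ‖g α‖) (one_lt_two)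
  rw [div_lt_iff₀ hgα] at hn
  have := key n
  linarith

theorem rado_dense (D : Set ℂ) (hD : IsOpen D) (hc : IsPreconnected D)
    (g : ℂ → ℂ) (hg : ContinuousOn g D)
    (hd : DifferentiableOn ℂ g {z | z ∈ D ∧ g z ≠ 0})
    (hne : {z | z ∈ D ∧ g z ≠ 0}.Nonempty) : D ⊆ closure {z | z ∈ D ∧ g z ≠ 0} := by
  have hl := rado_local D hD g hg hd
  set A : Set ℂ := {z | z ∈ D ∧ g z ≠ 0} with hA
  have hAo : IsOpen A := hg.isOpen_inter_preimage hD (isOpen_compl_singleton (x := (0 : ℂ)))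
  intro q hq
  by_contra hqA
  obtain ⟨a, ha⟩ := hne
  have hsep := hc (closure (D \ closure A))ᶜ (closure A)ᶜ isClosed_closure.isOpen_compl
    isClosed_closure.isOpen_compl
    (by
      intro z hz
      by_contra h
      simp only [Set.mem_union, Set.mem_compl_iff, not_or, not_not] at h
      exact hl z hz h.2 h.1)
    ⟨a, ha.1, by
      intro h
      obtain ⟨y, hy, hy'⟩ := mem_closure_iff.1 h A hAo ha
      exact hy'.2 (subset_closure hy)⟩
    ⟨q, hq, hqA⟩
  obtain ⟨z, hz, hz1, hz2⟩ := hsep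
  exact hz1 (subset_closure ⟨hz, hz2⟩)

theorem eq_of_integral_eq (D : Set (ℝ × ℝ)) (hD : IsOpen D) (a b : ℝ × ℝ → ℝ)
    (ha : ContinuousOn a D) (hb : ContinuousOn b D)
    (h : ∀ Ω : Set (ℝ × ℝ), IsOpen Ω → IsCompact (closure Ω) → closure Ω ⊆ D →
      ∫ p in Ω, a p = ∫ p in Ω, b p) (p : ℝ × ℝ) (hp : p ∈ D) : a p ≤ b p := by
  by_contra hlt
  push Not at hlt
  have hev : ∀ᶠ q in nhds p, b q < a q ∧ q ∈ D :=
    (((hb.continuousAt (hD.mem_nhds hp)).eventually_lt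
      (ha.continuousAt (hD.mem_nhds hp)) hlt)).and (hD.mem_nhds hp)
  obtain ⟨R, hR, hRD⟩ := Metric.nhds_basis_closedBall.mem_iff.1 hev
  have hsub : Metric.ball p R ⊆ Metric.closedBall p R := Metric.ball_subset_closedBall
  have hcl : closure (Metric.ball p R) ⊆ Metric.closedBall p R :=
    Metric.closure_ball_subset_closedBall
  have hint : ∀ c : ℝ × ℝ → ℝ, ContinuousOn c D → IntegrableOn c (Metric.ball p R) := by
    intro c hc
    exact ((hc.mono fun q hq => (hRD hq).2).integrableOn_compact
      (isCompact_closedBall p R)).mono_set hsub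
  have heq := h (Metric.ball p R) Metric.isOpen_ball
    ((isCompact_closedBall p R).of_isClosed_subset isClosed_closure hcl)
    (fun q hq => (hRD (hcl hq)).2)
  have h0 : ∫ q in Metric.ball p R, (a q - b q) = 0 := by
    rw [integral_sub (hint a ha) (hint b hb), heq, sub_self]
  have hpos : 0 < ∫ q in Metric.ball p R, (a q - b q) := by
    rw [setIntegral_pos_iff_support_of_nonneg_ae]
    · refine (Metric.measure_ball_pos volume p hR).trans_le (measure_mono ?_)
      intro q hq
      exact ⟨(sub_pos.2 (hRD (hsub hq)).1).ne', hq⟩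
    · filter_upwards [ae_restrict_mem measurableSet_ball] with q hq
      exact (sub_pos.2 (hRD (hsub hq)).1).le
    · exact (hint a ha).sub (hint b hb)
  linarith

/-- Real derivative of `u + i v`. -/
theorem hasFDerivAt_pair (u v : ℝ × ℝ → ℝ) (z : ℂ)
    (hu : DifferentiableAt ℝ u (z.re, z.im)) (hv : DifferentiableAt ℝ v (z.re, z.im)) :
    ∃ L : ℂ →L[ℝ] ℂ, HasFDerivAt
      (fun z : ℂ => (u (z.re, z.im) : ℂ) + (v (z.re, z.im) : ℂ) * Complex.I) L z ∧
      L 1 = (fderiv ℝ u (z.re, z.im) (1, 0) : ℂ) + (fderiv ℝ v (z.re, z.im) (1, 0) : ℂ) * Complex.I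
      ∧ L Complex.I =
        (fderiv ℝ u (z.re, z.im) (0, 1) : ℂ) + (fderiv ℝ v (z.re, z.im) (0, 1) : ℂ) * Complex.I := by
  have he : HasFDerivAt (fun z : ℂ => (z.re, z.im))
      (Complex.equivRealProdCLM : ℂ →L[ℝ] ℝ × ℝ) z :=
    Complex.equivRealProdCLM.hasFDerivAt
  have h1 := Complex.ofRealCLM.hasFDerivAt.comp z (HasFDerivAt.comp z hu.hasFDerivAt he)
  have h2 := Complex.ofRealCLM.hasFDerivAt.comp z (HasFDerivAt.comp z hv.hasFDerivAt he)
  refine ⟨_, h1.add (h2.mul_const Complex.I), ?_, ?_⟩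
  · simp [mul_comm]
  · simp [mul_comm]

theorem cr_iff (u v : ℝ × ℝ → ℝ) (z : ℂ)
    (hu : DifferentiableAt ℝ u (z.re, z.im)) (hv : DifferentiableAt ℝ v (z.re, z.im)) :
    DifferentiableAt ℂ
      (fun z : ℂ => (u (z.re, z.im) : ℂ) + (v (z.re, z.im) : ℂ) * Complex.I) z ↔
      (fderiv ℝ u (z.re, z.im) (1, 0) = fderiv ℝ v (z.re, z.im) (0, 1) ∧
       fderiv ℝ u (z.re, z.im) (0, 1) = - fderiv ℝ v (z.re, z.im) (1, 0)) := by
  obtain ⟨L, hL, hL1, hLI⟩ := hasFDerivAt_pair u v z hu hv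
  rw [differentiableAt_complex_iff_differentiableAt_real, hL.fderiv, hL1, hLI]
  constructor
  · rintro ⟨-, h⟩
    rw [Complex.ext_iff] at h
    simp at h
    exact ⟨h.2.symm, h.1⟩
  · rintro ⟨h1, h2⟩
    refine ⟨hL.differentiableAt, ?_⟩
    rw [h1, h2]
    apply Complex.ext <;> simp

theorem cr_deriv (u v : ℝ × ℝ → ℝ) (z : ℂ)
    (hu : DifferentiableAt ℝ u (z.re, z.im)) (hv : DifferentiableAt ℝ v (z.re, z.im))
    (hd : DifferentiableAt ℂ
      (fun z : ℂ => (u (z.re, z.im) : ℂ) + (v (z.re, z.im) : ℂ) * Complex.I) z) :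
    deriv (fun z : ℂ => (u (z.re, z.im) : ℂ) + (v (z.re, z.im) : ℂ) * Complex.I) z =
      (fderiv ℝ u (z.re, z.im) (1, 0) : ℂ)
        + (fderiv ℝ v (z.re, z.im) (1, 0) : ℂ) * Complex.I := by
  obtain ⟨L, hL, hL1, -⟩ := hasFDerivAt_pair u v z hu hv
  rw [← hL1, ← hL.fderiv, hd.fderiv_restrictScalars ℝ]
  simp

/-- Gradient of the modulus. -/
theorem fderiv_modulus (u v : ℝ × ℝ → ℝ) (p : ℝ × ℝ)
    (hu : DifferentiableAt ℝ u p) (hv : DifferentiableAt ℝ v p)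
    (hpos : 0 < u p ^ 2 + v p ^ 2) (e : ℝ × ℝ) :
    fderiv ℝ (fun p => Real.sqrt (u p ^ 2 + v p ^ 2)) p e =
      (u p * fderiv ℝ u p e + v p * fderiv ℝ v p e) / Real.sqrt (u p ^ 2 + v p ^ 2) := by
  have h := ((hu.hasFDerivAt.pow 2).add (hv.hasFDerivAt.pow 2)).sqrt hpos.ne'
  have h' : HasFDerivAt (fun p => Real.sqrt (u p ^ 2 + v p ^ 2)) _ p := h
  rw [h'.fderiv]
  have : Real.sqrt (u p ^ 2 + v p ^ 2) ≠ 0 := (Real.sqrt_pos.2 hpos).ne'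
  simp
  field_simp

theorem modulus_grad_sq (u v : ℝ × ℝ → ℝ) (p : ℝ × ℝ)
    (hu : DifferentiableAt ℝ u p) (hv : DifferentiableAt ℝ v p)
    (hpos : 0 < u p ^ 2 + v p ^ 2) :
    (u p ^ 2 + v p ^ 2) *
    (fderiv ℝ (fun p => Real.sqrt (u p ^ 2 + v p ^ 2)) p (1, 0) ^ 2 +
     fderiv ℝ (fun p => Real.sqrt (u p ^ 2 + v p ^ 2)) p (0, 1) ^ 2) =
     (u p * fderiv ℝ u p (1, 0) + v p * fderiv ℝ v p (1, 0)) ^ 2 +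
     (u p * fderiv ℝ u p (0, 1) + v p * fderiv ℝ v p (0, 1)) ^ 2 := by
  rw [fderiv_modulus u v p hu hv hpos, fderiv_modulus u v p hu hv hpos, div_pow, div_pow,
    Real.sq_sqrt hpos.le]
  field_simp

theorem area_of_grad (D : Set (ℝ × ℝ)) (hD : IsOpen D) (u v : ℝ × ℝ → ℝ)
    (hu : ContDiffOn ℝ 1 u D) (hv : ContDiffOn ℝ 1 v D)
    (hpos : ∀ p ∈ D, 0 < u p ^ 2 + v p ^ 2)
    (h1 : ∀ p ∈ D, fderiv ℝ u p (1, 0) ^ 2 + fderiv ℝ u p (0, 1) ^ 2 =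
      fderiv ℝ v p (1, 0) ^ 2 + fderiv ℝ v p (0, 1) ^ 2)
    (h2 : ∀ p ∈ D, fderiv ℝ u p (1, 0) * fderiv ℝ v p (1, 0) +
      fderiv ℝ u p (0, 1) * fderiv ℝ v p (0, 1) = 0)
    (Ω : Set (ℝ × ℝ)) (hΩ : IsOpen Ω) (hΩD : Ω ⊆ D) :
    graphArea u Ω = graphArea v Ω ∧
      graphArea v Ω = graphArea (fun p => Real.sqrt (u p ^ 2 + v p ^ 2)) Ω := by
  constructor
  · refine setIntegral_congr_fun hΩ.measurableSet fun p hp => ?_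
    have := h1 p (hΩD hp)
    simp only [add_assoc, this]
  · refine setIntegral_congr_fun hΩ.measurableSet fun p hp => ?_
    have hp' := hΩD hp
    have e1 := h1 p hp'
    have e2 := h2 p hp'
    have e3 := modulus_grad_sq u v p ((hu.differentiableOn one_ne_zero).differentiableAt
      (hD.mem_nhds hp')) ((hv.differentiableOn one_ne_zero).differentiableAt
      (hD.mem_nhds hp')) (hpos p hp')
    have e4 : fderiv ℝ v p (1, 0) ^ 2 + fderiv ℝ v p (0, 1) ^ 2 =
        fderiv ℝ (fun p => Real.sqrt (u p ^ 2 + v p ^ 2)) p (1, 0) ^ 2 +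
        fderiv ℝ (fun p => Real.sqrt (u p ^ 2 + v p ^ 2)) p (0, 1) ^ 2 := by
      apply mul_left_cancel₀ (hpos p hp').ne'
      rw [e3]
      linear_combination (- u p ^ 2) * e1 - 2 * u p * v p * e2
    simp only [add_assoc, e4]

theorem grad_of_area (D : Set (ℝ × ℝ)) (hD : IsOpen D) (u v : ℝ × ℝ → ℝ)
    (hu : ContDiffOn ℝ 1 u D) (hv : ContDiffOn ℝ 1 v D)
    (h : ∀ Ω : Set (ℝ × ℝ), IsOpen Ω → IsCompact (closure Ω) → closure Ω ⊆ D →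
      graphArea u Ω = graphArea v Ω) (p : ℝ × ℝ) (hp : p ∈ D) :
    fderiv ℝ u p (1, 0) ^ 2 + fderiv ℝ u p (0, 1) ^ 2 =
      fderiv ℝ v p (1, 0) ^ 2 + fderiv ℝ v p (0, 1) ^ 2 := by
  have hc : ∀ u : ℝ × ℝ → ℝ, ContDiffOn ℝ 1 u D → ContinuousOn (fun p =>
      Real.sqrt (1 + (fderiv ℝ u p (1, 0)) ^ 2 + (fderiv ℝ u p (0, 1)) ^ 2)) D := by
    intro u hu
    have := hu.continuousOn_fderiv_of_isOpen hD le_rfl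
    fun_prop
  have e := le_antisymm (eq_of_integral_eq D hD _ _ (hc u hu) (hc v hv) h p hp)
    (eq_of_integral_eq D hD _ _ (hc v hv) (hc u hu) (fun Ω a b c => (h Ω a b c).symm) p hp)
  rw [Real.sqrt_inj (by positivity) (by positivity)] at e
  linarith

theorem grad_orth (D : Set (ℝ × ℝ)) (hD : IsOpen D) (u v : ℝ × ℝ → ℝ)
    (hu : ContDiffOn ℝ 1 u D) (hv : ContDiffOn ℝ 1 v D)
    (hpos : ∀ p ∈ D, 0 < u p ^ 2 + v p ^ 2)
    (h : ∀ p ∈ D, u p * v p * (fderiv ℝ u p (1, 0) * fderiv ℝ v p (1, 0) +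
      fderiv ℝ u p (0, 1) * fderiv ℝ v p (0, 1)) = 0) (p : ℝ × ℝ) (hp : p ∈ D) :
    fderiv ℝ u p (1, 0) * fderiv ℝ v p (1, 0) +
      fderiv ℝ u p (0, 1) * fderiv ℝ v p (0, 1) = 0 := by
  by_contra hne
  have hcu := hu.continuousOn_fderiv_of_isOpen hD le_rfl
  have hcv := hv.continuousOn_fderiv_of_isOpen hD le_rfl
  have hc : ContinuousOn (fun p => fderiv ℝ u p (1, 0) * fderiv ℝ v p (1, 0) +
      fderiv ℝ u p (0, 1) * fderiv ℝ v p (0, 1)) D := by fun_prop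
  have hev := (hc.continuousAt (hD.mem_nhds hp)).eventually_ne hne
  have hDp := hD.mem_nhds hp
  have hz : ∀ᶠ q in nhds p, u q * v q = 0 := by
    filter_upwards [hev, hDp] with q h1 h2
    exact (mul_eq_zero.1 (h q h2)).resolve_right h1
  by_cases hup : u p = 0
  · have hvp : v p ≠ 0 := by
      intro hvp
      have := hpos p hp
      simp [hup, hvp] at this
    have : u =ᶠ[nhds p] fun _ => 0 := by
      filter_upwards [hz, (hv.continuousOn.continuousAt hDp).eventually_ne hvp] with q h1 h2
      exact (mul_eq_zero.1 h1).resolve_right h2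
    apply hne
    simp [this.fderiv_eq]
  · have : v =ᶠ[nhds p] fun _ => 0 := by
      filter_upwards [hz, (hu.continuousOn.continuousAt hDp).eventually_ne hup] with q h1 h2
      exact (mul_eq_zero.1 h1).resolve_left h2
    apply hne
    simp [this.fderiv_eq]

theorem hol_of_grad (D : Set (ℝ × ℝ)) (hD : IsOpen D) (hDconn : IsPreconnected D)
    (u v : ℝ × ℝ → ℝ)
    (hu : ContDiffOn ℝ 1 u D) (hv : ContDiffOn ℝ 1 v D)
    (h1 : ∀ p ∈ D, fderiv ℝ u p (1, 0) ^ 2 + fderiv ℝ u p (0, 1) ^ 2 =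
      fderiv ℝ v p (1, 0) ^ 2 + fderiv ℝ v p (0, 1) ^ 2)
    (h2 : ∀ p ∈ D, fderiv ℝ u p (1, 0) * fderiv ℝ v p (1, 0) +
      fderiv ℝ u p (0, 1) * fderiv ℝ v p (0, 1) = 0) :
    (∀ p ∈ D, fderiv ℝ u p (1, 0) = fderiv ℝ v p (0, 1) ∧
       fderiv ℝ u p (0, 1) = - fderiv ℝ v p (1, 0)) ∨
    (∀ p ∈ D, fderiv ℝ u p (1, 0) = - fderiv ℝ v p (0, 1) ∧
       fderiv ℝ u p (0, 1) = fderiv ℝ v p (1, 0)) := by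
  set e : ℂ → ℝ × ℝ := fun z => (z.re, z.im) with he
  have hec : Continuous e := by fun_prop
  set D' : Set ℂ := e ⁻¹' D with hD'
  have hD'o : IsOpen D' := hD.preimage hec
  have hD'c : IsPreconnected D' :=
    (Complex.equivRealProdCLM.toHomeomorph.isPreconnected_preimage (s := D)).2 hDconn
  have hmaps : Set.MapsTo e D' D := fun z hz => hz
  have hcu := (hu.continuousOn_fderiv_of_isOpen hD le_rfl).comp hec.continuousOn hmaps
  have hcv := (hv.continuousOn_fderiv_of_isOpen hD le_rfl).comp hec.continuousOn hmaps
  have hdu : ∀ z ∈ D', DifferentiableAt ℝ u (z.re, z.im) := fun z hz =>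
    (hu.differentiableOn one_ne_zero).differentiableAt (hD.mem_nhds hz)
  have hdv : ∀ z ∈ D', DifferentiableAt ℝ v (z.re, z.im) := fun z hz =>
    (hv.differentiableOn one_ne_zero).differentiableAt (hD.mem_nhds hz)
  simp only [Function.comp_def] at hcu hcv
  set g : ℂ → ℂ := fun z =>
    ((fderiv ℝ u (e z) (1, 0) + fderiv ℝ v (e z) (0, 1) : ℝ) : ℂ) +
    ((fderiv ℝ v (e z) (1, 0) - fderiv ℝ u (e z) (0, 1) : ℝ) : ℂ) * Complex.I with hg
  have hgc : ContinuousOn g D' := by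
    have a1 : ContinuousOn (fun z => fderiv ℝ u (e z) (1, 0) + fderiv ℝ v (e z) (0, 1)) D' := by
      fun_prop
    have a2 : ContinuousOn (fun z => fderiv ℝ v (e z) (1, 0) - fderiv ℝ u (e z) (0, 1)) D' := by
      fun_prop
    exact (Complex.continuous_ofReal.comp_continuousOn a1).add
      ((Complex.continuous_ofReal.comp_continuousOn a2).mul continuousOn_const)
  have hg0 : ∀ z, g z = 0 ↔ (fderiv ℝ u (e z) (1, 0) = - fderiv ℝ v (e z) (0, 1) ∧
       fderiv ℝ u (e z) (0, 1) = fderiv ℝ v (e z) (1, 0)) := by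
    intro z
    rw [Complex.ext_iff]
    simp only [hg, Complex.add_re, Complex.add_im, Complex.ofReal_re, Complex.ofReal_im,
      Complex.re_ofReal_mul, Complex.im_ofReal_mul, Complex.I_re, Complex.I_im, Complex.zero_re,
      Complex.zero_im]
    constructor
    · rintro ⟨a, b⟩
      constructor <;> linarith
    · rintro ⟨a, b⟩
      constructor <;> linarith
  have hA : ∀ z ∈ D', g z ≠ 0 → fderiv ℝ u (e z) (1, 0) = fderiv ℝ v (e z) (0, 1) ∧
       fderiv ℝ u (e z) (0, 1) = - fderiv ℝ v (e z) (1, 0) := by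
    intro z hz hgz
    rw [Ne, hg0] at hgz
    have e1 := h1 _ hz
    have e2 := h2 _ hz
    change fderiv ℝ u (e z) (1, 0) ^ 2 + fderiv ℝ u (e z) (0, 1) ^ 2 =
      fderiv ℝ v (e z) (1, 0) ^ 2 + fderiv ℝ v (e z) (0, 1) ^ 2 at e1
    generalize fderiv ℝ u (e z) (1, 0) = a at *
    generalize fderiv ℝ u (e z) (0, 1) = b at *
    generalize fderiv ℝ v (e z) (1, 0) = c at *
    generalize fderiv ℝ v (e z) (0, 1) = d at *
    have hpos : 0 < (a + d) ^ 2 + (b - c) ^ 2 := by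
      by_contra hn
      apply hgz
      constructor
      · have : a + d = 0 := by
          apply pow_eq_zero_iff two_ne_zero |>.1
          nlinarith [sq_nonneg (a + d), sq_nonneg (b - c)]
        linarith
      · have : b - c = 0 := by
          apply pow_eq_zero_iff two_ne_zero |>.1
          nlinarith [sq_nonneg (a + d), sq_nonneg (b - c)]
        linarith
    -- complex identity: product of the two Wirtinger derivatives vanishes
    have hr : (a + d) * (a - d) - (c - b) * (c + b) = 0 := by linear_combination e1
    have hi : (a + d) * (c + b) + (c - b) * (a - d) = 0 := by linear_combination 2 * e2
    constructor
    · have : ((a + d) ^ 2 + (b - c) ^ 2) * (a - d) = 0 := by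
        linear_combination (a + d) * hr + (c - b) * hi
      have := (mul_eq_zero.1 this).resolve_left hpos.ne'
      linarith
    · have : ((a + d) ^ 2 + (b - c) ^ 2) * (c + b) = 0 := by
        linear_combination (a + d) * hi - (c - b) * hr
      have := (mul_eq_zero.1 this).resolve_left hpos.ne'
      linarith
  have hAo : IsOpen {z | z ∈ D' ∧ g z ≠ 0} :=
    hgc.isOpen_inter_preimage hD'o (isOpen_compl_singleton (x := (0 : ℂ)))
  by_cases hne : {z | z ∈ D' ∧ g z ≠ 0}.Nonempty
  · left
    have hdF : ∀ z ∈ {z | z ∈ D' ∧ g z ≠ 0}, DifferentiableAt ℂ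
        (fun z : ℂ => (u (z.re, z.im) : ℂ) + (v (z.re, z.im) : ℂ) * Complex.I) z := fun z hz =>
      (cr_iff u v z (hdu z hz.1) (hdv z hz.1)).2 (hA z hz.1 hz.2)
    have hgd : DifferentiableOn ℂ g {z | z ∈ D' ∧ g z ≠ 0} := by
      refine ((DifferentiableOn.deriv (fun z hz => (hdF z hz).differentiableWithinAt)
        hAo).const_mul 2).congr ?_
      intro z hz
      rw [cr_deriv u v z (hdu z hz.1) (hdv z hz.1) (hdF z hz)]
      obtain ⟨q1, q2⟩ := hA z hz.1 hz.2
      simp only [hg]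
      rw [← q1, q2]
      push_cast
      ring
    have hdense := rado_dense D' hD'o hD'c g hgc hgd hne
    have hzero : ∀ k : ℂ → ℝ, ContinuousOn k D' → (∀ z ∈ {z | z ∈ D' ∧ g z ≠ 0}, k z = 0) →
        ∀ z ∈ D', k z = 0 := by
      intro k hk hk0 z hz
      by_contra hkz
      have hev : ∀ᶠ y in nhds z, k y ≠ 0 :=
        (hk.continuousAt (hD'o.mem_nhds hz)).eventually_ne hkz
      obtain ⟨y, hy1, hy2⟩ := mem_closure_iff_nhds.1 (hdense hz) _ hev
      exact hy1 (hk0 y hy2)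
    intro p hp
    have hpz : (⟨p.1, p.2⟩ : ℂ) ∈ D' := hp
    constructor
    · have := hzero (fun z => fderiv ℝ u (e z) (1, 0) - fderiv ℝ v (e z) (0, 1)) (by fun_prop)
        (fun z hz => sub_eq_zero.2 (hA z hz.1 hz.2).1) _ hpz
      exact sub_eq_zero.1 this
    · have := hzero (fun z => fderiv ℝ u (e z) (0, 1) - (- fderiv ℝ v (e z) (1, 0))) (by fun_prop)
        (fun z hz => sub_eq_zero.2 (hA z hz.1 hz.2).2) _ hpz
      exact sub_eq_zero.1 this
  · right
    intro p hp
    have hpz : (⟨p.1, p.2⟩ : ℂ) ∈ D' := hp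
    have : g ⟨p.1, p.2⟩ = 0 := by
      by_contra hn
      exact hne ⟨_, hpz, hn⟩
    exact (hg0 _).1 this

theorem hol_iff (D : Set (ℝ × ℝ)) (hD : IsOpen D) (u v : ℝ × ℝ → ℝ)
    (hu : ContDiffOn ℝ 1 u D) (hv : ContDiffOn ℝ 1 v D) :
    DifferentiableOn ℂ
        (fun z : ℂ => (u (z.re, z.im) : ℂ) + (v (z.re, z.im) : ℂ) * Complex.I)
        {z : ℂ | (z.re, z.im) ∈ D} ↔
    (∀ p ∈ D, fderiv ℝ u p (1, 0) = fderiv ℝ v p (0, 1) ∧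
       fderiv ℝ u p (0, 1) = - fderiv ℝ v p (1, 0)) := by
  have ho : IsOpen {z : ℂ | (z.re, z.im) ∈ D} :=
    hD.preimage (f := fun z : ℂ => (z.re, z.im)) (by fun_prop)
  have hdu : ∀ p ∈ D, DifferentiableAt ℝ u p := fun z hz =>
    (hu.differentiableOn one_ne_zero).differentiableAt (hD.mem_nhds hz)
  have hdv : ∀ p ∈ D, DifferentiableAt ℝ v p := fun z hz =>
    (hv.differentiableOn one_ne_zero).differentiableAt (hD.mem_nhds hz)
  constructor
  · intro h p hp
    have hpz : (⟨p.1, p.2⟩ : ℂ) ∈ {z : ℂ | (z.re, z.im) ∈ D} := hp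
    exact (cr_iff u v ⟨p.1, p.2⟩ (hdu p hp) (hdv p hp)).1 (h.differentiableAt (ho.mem_nhds hpz))
  · intro h z hz
    exact ((cr_iff u v z (hdu _ hz) (hdv _ hz)).2 (h _ hz)).differentiableWithinAt

theorem hol_conj_iff (D : Set (ℝ × ℝ)) (hD : IsOpen D) (u v : ℝ × ℝ → ℝ)
    (hu : ContDiffOn ℝ 1 u D) (hv : ContDiffOn ℝ 1 v D) :
    DifferentiableOn ℂ
        (fun z : ℂ => (u (z.re, z.im) : ℂ) - (v (z.re, z.im) : ℂ) * Complex.I)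
        {z : ℂ | (z.re, z.im) ∈ D} ↔
    (∀ p ∈ D, fderiv ℝ u p (1, 0) = - fderiv ℝ v p (0, 1) ∧
       fderiv ℝ u p (0, 1) = fderiv ℝ v p (1, 0)) := by
  have h := hol_iff D hD u (fun p => - v p) hu hv.neg
  simp only [fderiv_fun_neg, neg_apply, neg_neg, Complex.ofReal_neg,
    neg_mul, ← sub_eq_add_neg] at h
  exact h

/-- **Dzyadyk's geometric criterion of analyticity.** Let `D ⊆ ℝ² ≅ ℂ` be a nonempty open
connected set, `u, v : D → ℝ` continuously differentiable with `u² + v² > 0` on `D`, and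
`w = √(u² + v²)`. Then one of `f = u + iv`, `f̄ = u − iv` is holomorphic on `D` iff for every
open `Ω` with compact closure contained in `D` the areas of the graphs of `u`, `v`, `w`
over `Ω` coincide. -/
theorem dzyadyk_geometric_criterion_of_analyticity
    (D : Set (ℝ × ℝ)) (hD : IsOpen D) (hDconn : IsConnected D)
    (u v : ℝ × ℝ → ℝ)
    (hu : ContDiffOn ℝ 1 u D) (hv : ContDiffOn ℝ 1 v D)
    (hpos : ∀ p ∈ D, 0 < u p ^ 2 + v p ^ 2) :
    ((DifferentiableOn ℂ
        (fun z : ℂ => (u (z.re, z.im) : ℂ) + (v (z.re, z.im) : ℂ) * Complex.I)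
        {z : ℂ | (z.re, z.im) ∈ D} ∨
      DifferentiableOn ℂ
        (fun z : ℂ => (u (z.re, z.im) : ℂ) - (v (z.re, z.im) : ℂ) * Complex.I)
        {z : ℂ | (z.re, z.im) ∈ D})
      ↔
    (∀ Ω : Set (ℝ × ℝ), IsOpen Ω → IsCompact (closure Ω) → closure Ω ⊆ D →
      graphArea u Ω = graphArea v Ω ∧
      graphArea v Ω = graphArea (fun p => Real.sqrt (u p ^ 2 + v p ^ 2)) Ω)) := by
  have hdu : ∀ p ∈ D, DifferentiableAt ℝ u p := fun z hz =>
    (hu.differentiableOn one_ne_zero).differentiableAt (hD.mem_nhds hz)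
  have hdv : ∀ p ∈ D, DifferentiableAt ℝ v p := fun z hz =>
    (hv.differentiableOn one_ne_zero).differentiableAt (hD.mem_nhds hz)
  rw [hol_iff D hD u v hu hv, hol_conj_iff D hD u v hu hv]
  constructor
  · intro h Ω hΩ _ hΩD
    refine area_of_grad D hD u v hu hv hpos ?_ ?_ Ω hΩ (subset_closure.trans hΩD)
    · intro p hp
      rcases h with h | h <;> obtain ⟨h1, h2⟩ := h p hp <;> rw [h1, h2] <;> ring
    · intro p hp
      rcases h with h | h <;> obtain ⟨h1, h2⟩ := h p hp <;> rw [h1, h2] <;> ring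
  · intro h
    have hw : ContDiffOn ℝ 1 (fun p => Real.sqrt (u p ^ 2 + v p ^ 2)) D :=
      ((hu.pow 2).add (hv.pow 2)).sqrt fun p hp => (hpos p hp).ne'
    have h1 := grad_of_area D hD u v hu hv fun Ω a b c => (h Ω a b c).1
    have h2 := grad_of_area D hD v _ hv hw fun Ω a b c => (h Ω a b c).2
    refine hol_of_grad D hD hDconn.isPreconnected u v hu hv h1
      (grad_orth D hD u v hu hv hpos ?_)
    intro p hp
    have e1 := h1 p hp
    have e2 := h2 p hp
    have e3 := modulus_grad_sq u v p (hdu p hp) (hdv p hp) (hpos p hp)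
    rw [← e2] at e3
    linear_combination (-1 / 2) * e3 - (u p ^ 2 / 2) * e1
end
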